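/- arXiv:2106.03268 — 8 statements merged into one kernel-verified Lean document; each statement's English description precedes it below -/
import Mathlib

section
/- Let C2 = {(u,v) ∈ ℝ^n × ℝ^n : u ≥ 0, v ≥ 0, ⟨u,v⟩ = 0}. For any w = (u,v) ∈ ℝ^n × ℝ^n and any z = (p,q) ∈ P_{C2}(w), the following holds for each index i ∈ {1,…,n}: if u_i < v_i then (p_i, q_i) = (0, max(v_i,0)); if u_i > v_i then (p_i, q_i) = (max(u_i,0), 0); and if u_i = v_i then (p_i, q_i) ∈ {(0, max(v_i,0)), (max(u_i,0), 0)}. -/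
noncomputable section

/-- The (possibly multivalued) metric projection onto a set `S`. -/
def projSet {E : Type*} [NormedAddCommGroup E] (S : Set E) (z : E) : Set E :=
  {s ∈ S | ∀ t ∈ S, ‖s - z‖ ≤ ‖t - z‖}

/-- `C2 = {(u,v) ∈ ℝⁿ × ℝⁿ : u ≥ 0, v ≥ 0, ⟨u,v⟩ = 0}`, inside Euclidean `ℝ^{2n}`
indexed by `Fin n ⊕ Fin n` (`Sum.inl i` is `u_i`, `Sum.inr i` is `v_i`). -/
def C2set (n : ℕ) : Set (EuclideanSpace ℝ (Fin n ⊕ Fin n)) :=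
  {w | (∀ i, 0 ≤ w (Sum.inl i)) ∧ (∀ i, 0 ≤ w (Sum.inr i)) ∧
       ∑ i, w (Sum.inl i) * w (Sum.inr i) = 0}

theorem C2set_mul_eq_zero {n : ℕ} {z : EuclideanSpace ℝ (Fin n ⊕ Fin n)} (hz : z ∈ C2set n)
    (i : Fin n) : z (Sum.inl i) * z (Sum.inr i) = 0 :=
  (Finset.sum_eq_zero_iff_of_nonneg fun j _ => mul_nonneg (hz.1 j) (hz.2.1 j)).1 hz.2.2 i
    (Finset.mem_univ i)

/-- A projection onto `C2` minimizes the distance in each coordinate pair separately. -/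
theorem projSet_C2set_coord_le {n : ℕ} {w z : EuclideanSpace ℝ (Fin n ⊕ Fin n)}
    (hz : z ∈ projSet (C2set n) w) (i : Fin n) {a b : ℝ} (ha : 0 ≤ a) (hb : 0 ≤ b)
    (hab : a * b = 0) :
    (z (Sum.inl i) - w (Sum.inl i)) ^ 2 + (z (Sum.inr i) - w (Sum.inr i)) ^ 2 ≤
      (a - w (Sum.inl i)) ^ 2 + (b - w (Sum.inr i)) ^ 2 := by
  obtain ⟨hzC, hmin⟩ := hz
  let t : EuclideanSpace ℝ (Fin n ⊕ Fin n) := WithLp.toLp 2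
    (Sum.elim (Function.update (fun j => z (Sum.inl j)) i a)
      (Function.update (fun j => z (Sum.inr j)) i b))
  have tl : t (Sum.inl i) = a := by simp [t]
  have tr : t (Sum.inr i) = b := by simp [t]
  have tl' : ∀ j, j ≠ i → t (Sum.inl j) = z (Sum.inl j) := fun j h => by simp [t, h]
  have tr' : ∀ j, j ≠ i → t (Sum.inr j) = z (Sum.inr j) := fun j h => by simp [t, h]
  have ht : t ∈ C2set n := by
    refine ⟨fun j => ?_, fun j => ?_, Finset.sum_eq_zero fun j _ => ?_⟩ <;>
      rcases eq_or_ne j i with rfl | h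
    · rwa [tl]
    · rw [tl' j h]; exact hzC.1 j
    · rwa [tr]
    · rw [tr' j h]; exact hzC.2.1 j
    · rwa [tl, tr]
    · rw [tl' j h, tr' j h]; exact C2set_mul_eq_zero hzC j
  have key := pow_le_pow_left₀ (norm_nonneg _) (hmin t ht) 2
  simp only [EuclideanSpace.real_norm_sq_eq, Fintype.sum_sum_type, PiLp.sub_apply,
    ← Finset.sum_add_distrib] at key
  rw [← Finset.add_sum_erase _ _ (Finset.mem_univ i),
    ← Finset.add_sum_erase Finset.univ (fun j => (t (Sum.inl j) - w (Sum.inl j)) ^ 2 +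
      (t (Sum.inr j) - w (Sum.inr j)) ^ 2) (Finset.mem_univ i),
    Finset.sum_congr rfl (fun j hj => by
      rw [tl' j (Finset.ne_of_mem_erase hj), tr' j (Finset.ne_of_mem_erase hj)] :
      ∀ j ∈ Finset.univ.erase i, (t (Sum.inl j) - w (Sum.inl j)) ^ 2 +
        (t (Sum.inr j) - w (Sum.inr j)) ^ 2 = (z (Sum.inl j) - w (Sum.inl j)) ^ 2 +
        (z (Sum.inr j) - w (Sum.inr j)) ^ 2), tl, tr] at key
  exact le_of_add_le_add_right key

/-- The nearest nonnegative number to `u` is `max u 0`. -/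
theorem eq_max_zero_of_sq_sub_le {p u : ℝ} (hp : 0 ≤ p) (h : (p - u) ^ 2 ≤ (max u 0 - u) ^ 2) :
    p = max u 0 := by
  rcases le_total u 0 with hu | hu
  · rw [max_eq_right hu] at h ⊢
    nlinarith
  · rw [max_eq_left hu] at h ⊢
    nlinarith

/-- In the plane, a nearest point of the complementarity set with positive first coordinate forces
`v ≤ u`. -/
theorem le_of_nearest_of_pos {p u v : ℝ} (hp : 0 < p)
    (h : ∀ a b : ℝ, 0 ≤ a → 0 ≤ b → a * b = 0 →
      (p - u) ^ 2 + (0 - v) ^ 2 ≤ (a - u) ^ 2 + (b - v) ^ 2) : v ≤ u := by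
  have h0 := h 0 0 le_rfl le_rfl (by simp)
  by_contra! huv
  have hu : 0 < u := by nlinarith
  have := h 0 v le_rfl (by linarith) (by simp)
  nlinarith [sq_nonneg (p - u)]

theorem projection_onto_C2 {n : ℕ} (w : EuclideanSpace ℝ (Fin n ⊕ Fin n))
    (z : EuclideanSpace ℝ (Fin n ⊕ Fin n)) (hz : z ∈ projSet (C2set n) w) (i : Fin n) :
    (w (Sum.inl i) < w (Sum.inr i) →
      z (Sum.inl i) = 0 ∧ z (Sum.inr i) = max (w (Sum.inr i)) 0) ∧
    (w (Sum.inl i) > w (Sum.inr i) →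
      z (Sum.inl i) = max (w (Sum.inl i)) 0 ∧ z (Sum.inr i) = 0) ∧
    (w (Sum.inl i) = w (Sum.inr i) →
      (z (Sum.inl i) = 0 ∧ z (Sum.inr i) = max (w (Sum.inr i)) 0) ∨
      (z (Sum.inl i) = max (w (Sum.inl i)) 0 ∧ z (Sum.inr i) = 0)) := by
  have hmin := fun a b ha hb hab => projSet_C2set_coord_le hz i (a := a) (b := b) ha hb hab
  have hp := hz.1.1 i
  have hq := hz.1.2.1 i
  have hpq := C2set_mul_eq_zero hz.1 i
  generalize z (Sum.inl i) = p at *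
  generalize z (Sum.inr i) = q at *
  generalize w (Sum.inl i) = u at *
  generalize w (Sum.inr i) = v at *
  have left_max (hq0 : q = 0) : p = max u 0 := by
    have := hmin (max u 0) 0 (le_max_right _ _) le_rfl (mul_zero _)
    exact eq_max_zero_of_sq_sub_le hp (by rw [hq0] at this; linarith)
  have right_max (hp0 : p = 0) : q = max v 0 := by
    have := hmin 0 (max v 0) le_rfl (le_max_right _ _) (zero_mul _)
    exact eq_max_zero_of_sq_sub_le hq (by rw [hp0] at this; linarith)
  refine ⟨fun huv => ?_, fun huv => ?_, fun _ => ?_⟩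
  · have hp0 : p = 0 := by
      by_contra hne
      obtain rfl : q = 0 := (mul_eq_zero.1 hpq).resolve_left hne
      exact huv.not_ge (le_of_nearest_of_pos (lt_of_le_of_ne hp (Ne.symm hne)) hmin)
    exact ⟨hp0, right_max hp0⟩
  · have hq0 : q = 0 := by
      by_contra hne
      obtain rfl : p = 0 := (mul_eq_zero.1 hpq).resolve_right hne
      refine huv.not_ge (le_of_nearest_of_pos (lt_of_le_of_ne hq (Ne.symm hne))
        fun a b ha hb hab => ?_)
      linarith [hmin b a hb ha (by rwa [mul_comm])]
    exact ⟨left_max hq0, hq0⟩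
  · rcases mul_eq_zero.1 hpq with h | h
    · exact Or.inl ⟨h, right_max h⟩
    · exact Or.inr ⟨left_max h, h⟩
end
end

section
/- Let C2 = {(u,v) ∈ ℝ^n × ℝ^n : u ≥ 0, v ≥ 0, ⟨u,v⟩ = 0}, and fix any function τ : {1,…,n} → {1,2}. Then the metric projection P_{C2} is firmly nonexpansive on S_τ: for all w, w' ∈ S_τ and all p ∈ P_{C2}(w), p' ∈ P_{C2}(w'), one has ‖p − p'‖² ≤ ⟨w − w', p − p'⟩. -/
open scoped RealInnerProductSpace

noncomputable section

/-- `K1 = {(a,b) : a > b or a = b ≤ 0}`. -/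
def K1 (a b : ℝ) : Prop := a > b ∨ (a = b ∧ a ≤ 0)

/-- `K2 = {(a,b) : a < b or a = b ≤ 0}`. -/
def K2 (a b : ℝ) : Prop := a < b ∨ (a = b ∧ a ≤ 0)

/-- `S_τ`, for `τ : {1,…,n} → {1,2}` (encoded as `τ : Fin n → Fin 2`, with value `0`
corresponding to `K1` and value `1` corresponding to `K2`). -/
def Stau {n : ℕ} (τ : Fin n → Fin 2) : Set (EuclideanSpace ℝ (Fin n ⊕ Fin n)) :=
  {w | ∀ i, (τ i = 0 → K1 (w (Sum.inl i)) (w (Sum.inr i))) ∧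
            (τ i = 1 → K2 (w (Sum.inl i)) (w (Sum.inr i)))}

/-- Points of `C2set n` have complementary coordinate pairs. -/
theorem mul_eq_zero_of_mem_C2set {n : ℕ} {p : EuclideanSpace ℝ (Fin n ⊕ Fin n)}
    (hp : p ∈ C2set n) (i : Fin n) : p (Sum.inl i) * p (Sum.inr i) = 0 :=
  (Finset.sum_eq_zero_iff_of_nonneg fun j _ => mul_nonneg (hp.1 j) (hp.2.1 j)).1 hp.2.2 i
    (Finset.mem_univ i)

/-- A nearest point of `C2set n` is nearest in each coordinate pair. -/
theorem coord_le_of_mem_projSet_C2set {n : ℕ} {w p : EuclideanSpace ℝ (Fin n ⊕ Fin n)}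
    (hp : p ∈ projSet (C2set n) w) (i : Fin n) {x y : ℝ} (hx : 0 ≤ x) (hy : 0 ≤ y)
    (hxy : x * y = 0) :
    (p (Sum.inl i) - w (Sum.inl i)) ^ 2 + (p (Sum.inr i) - w (Sum.inr i)) ^ 2 ≤
      (x - w (Sum.inl i)) ^ 2 + (y - w (Sum.inr i)) ^ 2 := by
  obtain ⟨hpC, hmin⟩ := hp
  let t : EuclideanSpace ℝ (Fin n ⊕ Fin n) := WithLp.toLp 2
    (Sum.elim (Function.update (fun j => p (Sum.inl j)) i x)
      (Function.update (fun j => p (Sum.inr j)) i y))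
  have htl : ∀ j, t (Sum.inl j) = if j = i then x else p (Sum.inl j) := fun j => by
    simp [t, Function.update_apply]
  have htr : ∀ j, t (Sum.inr j) = if j = i then y else p (Sum.inr j) := fun j => by
    simp [t, Function.update_apply]
  have ht : t ∈ C2set n := by
    refine ⟨fun j => ?_, fun j => ?_, Finset.sum_eq_zero fun j _ => ?_⟩
    · rw [htl]; split_ifs; exacts [hx, hpC.1 j]
    · rw [htr]; split_ifs; exacts [hy, hpC.2.1 j]
    · rw [htl, htr]; split_ifs; exacts [hxy, mul_eq_zero_of_mem_C2set hpC j]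
  have h := pow_le_pow_left₀ (norm_nonneg _) (hmin t ht) 2
  rw [EuclideanSpace.real_norm_sq_eq, EuclideanSpace.real_norm_sq_eq, Fintype.sum_sum_type,
    Fintype.sum_sum_type, ← Finset.sum_add_distrib, ← Finset.sum_add_distrib,
    ← Finset.add_sum_erase _ _ (Finset.mem_univ i),
    ← Finset.add_sum_erase _ _ (Finset.mem_univ i)] at h
  have hrest : ∀ j ∈ Finset.univ.erase i,
      (t - w) (Sum.inl j) ^ 2 + (t - w) (Sum.inr j) ^ 2 =
        (p - w) (Sum.inl j) ^ 2 + (p - w) (Sum.inr j) ^ 2 := fun j hj => by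
    simp [htl, htr, Finset.ne_of_mem_erase hj]
  rw [Finset.sum_congr rfl hrest] at h
  have hle := le_of_add_le_add_right h
  simpa [htl, htr] using hle

/-- On `K1`, the nearest complementary pair is `(max a 0, 0)`. -/
theorem eq_of_K1_of_forall_le {a b x y : ℝ} (hab : K1 a b) (hx : 0 ≤ x) (hy : 0 ≤ y)
    (hxy : x * y = 0)
    (hmin : (x - a) ^ 2 + (y - b) ^ 2 ≤ (max a 0 - a) ^ 2 + (0 - b) ^ 2) :
    x = max a 0 ∧ y = 0 := by
  have hba : b ≤ a := by rcases hab with h | h <;> linarith [h]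
  rcases le_total a 0 with ha | ha
  · rw [max_eq_right ha] at hmin ⊢
    constructor <;> nlinarith [mul_nonneg hx (neg_nonneg.2 ha),
      mul_nonneg hy (neg_nonneg.2 (hba.trans ha))]
  · rw [max_eq_left ha] at hmin ⊢
    rcases mul_eq_zero.1 hxy with rfl | rfl
    · rcases le_or_gt b 0 with hb | hb
      · have hyb := mul_nonneg hy (neg_nonneg.2 hb)
        exact ⟨by nlinarith [sq_nonneg y], by nlinarith [sq_nonneg a]⟩
      · have hlt : b < a := by rcases hab with h | h <;> linarith [h]
        nlinarith [sq_nonneg (y - b)]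
    · exact ⟨by nlinarith, rfl⟩

/-- The positive part is firmly nonexpansive on the real line. -/
theorem sq_sub_max_zero_le (a b : ℝ) :
    (max a 0 - max b 0) ^ 2 ≤ (a - b) * (max a 0 - max b 0) := by
  rcases le_total a 0 with ha | ha <;> rcases le_total b 0 with hb | hb <;>
    simp only [max_eq_left, max_eq_right, ha, hb] <;> nlinarith

/-- Swapping the coordinates takes `K2` to `K1`. -/
theorem K1_swap_of_K2 {a b : ℝ} (h : K2 a b) : K1 b a :=
  h.imp id fun ⟨hab, ha⟩ => ⟨hab.symm, hab ▸ ha⟩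

theorem PC2_firmly_nonexpansive_on_Stau {n : ℕ} (τ : Fin n → Fin 2)
    (w w' : EuclideanSpace ℝ (Fin n ⊕ Fin n)) (hw : w ∈ Stau τ) (hw' : w' ∈ Stau τ)
    (p p' : EuclideanSpace ℝ (Fin n ⊕ Fin n))
    (hp : p ∈ projSet (C2set n) w) (hp' : p' ∈ projSet (C2set n) w') :
    ‖p - p'‖ ^ 2 ≤ ⟪w - w', p - p'⟫ := by
  rw [EuclideanSpace.real_norm_sq_eq, PiLp.inner_apply, Fintype.sum_sum_type,
    Fintype.sum_sum_type, ← Finset.sum_add_distrib, ← Finset.sum_add_distrib]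
  refine Finset.sum_le_sum fun i _ => ?_
  have hz := mul_eq_zero_of_mem_C2set hp.1 i
  have hz' := mul_eq_zero_of_mem_C2set hp'.1 i
  have hmin {x y : ℝ} := coord_le_of_mem_projSet_C2set hp i (x := x) (y := y)
  have hmin' {x y : ℝ} := coord_le_of_mem_projSet_C2set hp' i (x := x) (y := y)
  simp only [PiLp.sub_apply, RCLike.inner_apply, conj_trivial]
  rcases Fin.exists_fin_two.1 ⟨τ i, rfl⟩ with hτ | hτ
  · obtain ⟨h₁, h₂⟩ := eq_of_K1_of_forall_le ((hw i).1 hτ) (hp.1.1 i) (hp.1.2.1 i) hz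
      (hmin (le_max_right _ _) le_rfl (mul_zero _))
    obtain ⟨h₁', h₂'⟩ := eq_of_K1_of_forall_le ((hw' i).1 hτ) (hp'.1.1 i) (hp'.1.2.1 i) hz'
      (hmin' (le_max_right _ _) le_rfl (mul_zero _))
    rw [h₁, h₂, h₁', h₂']
    linarith [sq_sub_max_zero_le (w (Sum.inl i)) (w' (Sum.inl i))]
  · have hK := K1_swap_of_K2 ((hw i).2 hτ)
    have hK' := K1_swap_of_K2 ((hw' i).2 hτ)
    rw [mul_comm] at hz hz'
    obtain ⟨h₁, h₂⟩ := eq_of_K1_of_forall_le hK (hp.1.2.1 i) (hp.1.1 i) hz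
      (by linarith [hmin le_rfl (le_max_right (w (Sum.inr i)) 0) (zero_mul _)])
    obtain ⟨h₁', h₂'⟩ := eq_of_K1_of_forall_le hK' (hp'.1.2.1 i) (hp'.1.1 i) hz'
      (by linarith [hmin' le_rfl (le_max_right (w' (Sum.inr i)) 0) (zero_mul _)])
    rw [h₁, h₂, h₁', h₂']
    linarith [sq_sub_max_zero_le (w (Sum.inr i)) (w' (Sum.inr i))]
end
end

section
/- Let A, B ∈ ℝ^{m×n}, c ∈ ℝ^m with c ≠ 0, and suppose C1 ∩ C2 ≠ ∅. Then for every w ∈ C2 and every nearest point w̄ of w in C1 (i.e., w̄ ∈ P_{C1}(w)), w̄ does not lie in the nonpositive orthant of ℝ^{2n}; that is, w̄ has at least one strictly positive coordinate. Consequently, any sequence (w^k) generated by the alternating projections iteration w^{k+1} ∈ P_{C1}(P_{C2}(w^k)) satisfies w^k ∉ ℝ^{2n}_− for all k ≥ 1. -/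
noncomputable section

/-- `T(u,v) = (A+B)u + (−A+B)v`. -/
def Tmap {m n : ℕ} (A B : Matrix (Fin m) (Fin n) ℝ)
    (w : EuclideanSpace ℝ (Fin n ⊕ Fin n)) : Fin m → ℝ :=
  (A + B).mulVec (fun i => w (Sum.inl i)) + (-A + B).mulVec (fun i => w (Sum.inr i))

/-- `C1 = {w : Tw = √2 c}`. -/
def C1set {m n : ℕ} (A B : Matrix (Fin m) (Fin n) ℝ) (c : Fin m → ℝ) :
    Set (EuclideanSpace ℝ (Fin n ⊕ Fin n)) :=
  {w | Tmap A B w = Real.sqrt 2 • c}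

theorem inner_sub_le_zero_of_mem_projSet {E : Type*} [NormedAddCommGroup E]
    [InnerProductSpace ℝ E] {S : Set E} (hS : Convex ℝ S) {z s t : E}
    (hs : s ∈ projSet S z) (ht : t ∈ S) : inner ℝ (z - s) (t - s) ≤ 0 := by
  refine (norm_eq_iInf_iff_real_inner_le_zero hS hs.1).1 ?_ t ht
  have : Nonempty S := ⟨⟨s, hs.1⟩⟩
  refine le_antisymm (le_ciInf fun x => ?_) (ciInf_le ⟨0, ?_⟩ (⟨s, hs.1⟩ : S))
  · rw [norm_sub_rev, norm_sub_rev z]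
    exact hs.2 x x.2
  · rintro _ ⟨x, rfl⟩
    exact norm_nonneg _

theorem convex_C1set {m n : ℕ} (A B : Matrix (Fin m) (Fin n) ℝ) (c : Fin m → ℝ) :
    Convex ℝ (C1set A B c) := by
  intro x hx y hy a b _ _ hab
  have hT : Tmap A B (a • x + b • y) = a • Tmap A B x + b • Tmap A B y := by
    have h (f : Fin n → Fin n ⊕ Fin n) :
        (fun i => (a • x + b • y) (f i)) = a • (fun i => x (f i)) + b • fun i => y (f i) := by
      ext i
      simp
    simp only [Tmap, h, Matrix.mulVec_add, Matrix.mulVec_smul]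
    module
  change Tmap A B (a • x + b • y) = _
  rw [hT, show Tmap A B x = _ from hx, show Tmap A B y = _ from hy, ← add_smul, hab, one_smul]

theorem zero_notMem_C1set {m n : ℕ} (A B : Matrix (Fin m) (Fin n) ℝ) {c : Fin m → ℝ}
    (hc : c ≠ 0) : (0 : EuclideanSpace ℝ (Fin n ⊕ Fin n)) ∉ C1set A B c := by
  intro h
  have hT : Tmap A B 0 = 0 := by
    ext i
    simp [Tmap, Matrix.mulVec, dotProduct]
  have h' : Tmap A B 0 = Real.sqrt 2 • c := h
  rw [hT, eq_comm, smul_eq_zero] at h'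
  exact h'.elim (by positivity) hc

theorem nonneg_of_mem_C2set {n : ℕ} {w : EuclideanSpace ℝ (Fin n ⊕ Fin n)}
    (hw : w ∈ C2set n) (j : Fin n ⊕ Fin n) : 0 ≤ w j := by
  cases j with
  | inl i => exact hw.1 i
  | inr i => exact hw.2.1 i

/-- The projection of a nonnegative vector onto a convex set that contains a nonnegative vector
but not the origin has a positive coordinate. -/
theorem exists_pos_of_mem_projSet {ι : Type*} [Fintype ι] {S : Set (EuclideanSpace ℝ ι)}
    (hS : Convex ℝ S) (h0 : 0 ∉ S) {w z s : EuclideanSpace ℝ ι} (hw : ∀ j, 0 ≤ w j)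
    (hz : ∀ j, 0 ≤ z j) (hzS : z ∈ S) (hs : s ∈ projSet S w) : ∃ j, 0 < s j := by
  by_contra! hneg
  have hle := inner_sub_le_zero_of_mem_projSet hS hs hzS
  have hsq : ∑ j, s j * s j ≤ inner ℝ (w - s) (z - s) := by
    simp only [PiLp.inner_apply, PiLp.sub_apply, RCLike.inner_apply, conj_trivial]
    refine Finset.sum_le_sum fun j _ => ?_
    nlinarith [mul_nonneg (hw j) (hz j), mul_nonneg (hw j) (neg_nonneg.2 (hneg j)),
      mul_nonneg (hz j) (neg_nonneg.2 (hneg j))]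
  have hsum : ∑ j, s j * s j = 0 :=
    le_antisymm (hsq.trans hle) (Finset.sum_nonneg fun j _ => mul_self_nonneg _)
  have hs0 : s = 0 := by
    ext j
    exact mul_self_eq_zero.1
      ((Finset.sum_eq_zero_iff_of_nonneg fun j _ => mul_self_nonneg _).1 hsum j
        (Finset.mem_univ j))
  exact h0 (hs0 ▸ hs.1)

theorem MAP_iterates_not_in_nonpositive_orthant {m n : ℕ}
    (A B : Matrix (Fin m) (Fin n) ℝ) (c : Fin m → ℝ) (hc : c ≠ 0)
    (hfeas : (C1set A B c ∩ C2set n).Nonempty) :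
    (∀ w ∈ C2set n, ∀ wbar ∈ projSet (C1set A B c) w, ∃ j, 0 < wbar j) ∧
    (∀ w : ℕ → EuclideanSpace ℝ (Fin n ⊕ Fin n),
      (∀ k, ∃ w' ∈ projSet (C2set n) (w k), w (k + 1) ∈ projSet (C1set A B c) w') →
      ∀ k ≥ 1, ∃ j, 0 < w k j) := by
  obtain ⟨z, hz1, hz2⟩ := hfeas
  have key : ∀ w ∈ C2set n, ∀ wbar ∈ projSet (C1set A B c) w, ∃ j, 0 < wbar j :=
    fun w hw wbar hwbar => exists_pos_of_mem_projSet (convex_C1set A B c)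
      (zero_notMem_C1set A B hc) (nonneg_of_mem_C2set hw) (nonneg_of_mem_C2set hz2) hz1 hwbar
  refine ⟨key, fun w hstep k hk => ?_⟩
  obtain ⟨k, rfl⟩ := Nat.exists_eq_add_of_le' hk
  obtain ⟨w', hw', hnext⟩ := hstep k
  exact key w' hw'.1 _ hnext
end
end

section
/- Let A, Q ∈ ℝ^{n×n} be nonsingular matrices, where Q is nondegenerate (all principal minors of Q are nonzero), and let B = AQ. Let Λ ⊆ {1,…,n} and let A' be the n×n matrix obtained from A by replacing, for each j ∈ Λ, the j-th column of A by the j-th column of B. Then A' is nonsingular. -/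
noncomputable section

/-- A matrix is nondegenerate if all of its principal minors are nonzero. -/
def Nondegenerate {n : ℕ} (Q : Matrix (Fin n) (Fin n) ℝ) : Prop :=
  ∀ Λ : Finset (Fin n),
    (Q.submatrix (fun i : Λ => (i : Fin n)) (fun j : Λ => (j : Fin n))).det ≠ 0

/-- Replacing columns of the identity by the corresponding columns of `Q` gives a matrix whose
determinant is the principal minor of `Q` on the replaced columns. -/
theorem det_replace_columns_one {ι R : Type*} [Fintype ι] [DecidableEq ι] [CommRing R]
    (Q : Matrix ι ι R) (Λ : Finset ι) :
    (Matrix.of fun i j => if j ∈ Λ then Q i j else (1 : Matrix ι ι R) i j).det =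
      (Q.submatrix (fun i : Λ => (i : ι)) (fun j : Λ => (j : ι))).det := by
  rw [Matrix.twoBlockTriangular_det' _ (fun i => i ∈ Λ)]
  · have hone : Matrix.toSquareBlockProp
        (Matrix.of fun i j => if j ∈ Λ then Q i j else (1 : Matrix ι ι R) i j)
        (fun i => i ∉ Λ) = 1 := by
      ext i j
      simp [Matrix.toSquareBlockProp_def, j.2, Matrix.one_apply, Subtype.ext_iff]
    rw [hone, Matrix.det_one, mul_one]
    have hQ : Matrix.toSquareBlockProp
        (Matrix.of fun i j => if j ∈ Λ then Q i j else (1 : Matrix ι ι R) i j)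
        (fun i => i ∈ Λ) = Q.submatrix Subtype.val Subtype.val := by
      ext i j
      simp [Matrix.toSquareBlockProp_def]
    rw [hQ]
    convert! rfl
  · intro i hi j hj
    have hij : i ≠ j := fun h => hj (h ▸ hi)
    simp [hj, hij]

/-- Replacing columns of `A` by those of `A * Q` amounts to multiplying `A` by the identity with
the corresponding columns replaced by those of `Q`. -/
theorem replace_columns_mul {ι R : Type*} [Fintype ι] [DecidableEq ι] [CommRing R]
    (A Q : Matrix ι ι R) (Λ : Finset ι) :
    (Matrix.of fun i j => if j ∈ Λ then (A * Q) i j else A i j) =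
      A * Matrix.of fun i j => if j ∈ Λ then Q i j else (1 : Matrix ι ι R) i j := by
  ext i j
  by_cases hj : j ∈ Λ <;> simp [Matrix.mul_apply, hj, Matrix.one_apply]

theorem switching_columns_nonsingular {n : ℕ} (A Q : Matrix (Fin n) (Fin n) ℝ)
    (hA : A.det ≠ 0) (hQ : Q.det ≠ 0) (hQnd : Nondegenerate Q)
    (Λ : Finset (Fin n)) :
    (Matrix.of fun i j => if j ∈ Λ then (A * Q) i j else A i j).det ≠ 0 := by
  rw [replace_columns_mul, Matrix.det_mul, det_replace_columns_one]
  exact mul_ne_zero hA (hQnd Λ)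
end
end

section
/- Let m = n, let A, B ∈ ℝ^{n×n} with A − B nonsingular, and suppose Q = (Aᵀ+Bᵀ)(Aᵀ−Bᵀ)⁻¹ is nondegenerate. Let Λ1 ⊆ {1,…,n} and Λ2 = {n+i : i ∉ Λ1}. Then: (i) the columns of the n×2n block matrix [I_n Q] indexed by Λ1 ∪ Λ2 are linearly independent; (ii) consequently (Ker T)^⊥ ∩ Ĉ2 = {0}, where T = [A+B −A+B] and Ĉ2 = {(u,v) ∈ ℝ^n × ℝ^n : u_i v_i = 0 for all i}. -/
open scoped RealInnerProductSpace

noncomputable section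

/-- The columns of the block matrix `[Iₙ Q]`, indexed by `Fin n ⊕ Fin n`:
`Sum.inl i` gives the `i`-th column of `Iₙ` and `Sum.inr i` gives the `i`-th column of `Q`. -/
def Dcol {n : ℕ} (Q : Matrix (Fin n) (Fin n) ℝ) : Fin n ⊕ Fin n → Fin n → ℝ :=
  Sum.elim (fun i => Pi.single i (1 : ℝ)) (fun i => fun k => Q k i)

open Matrix in
/-- If `Q` is nondegenerate, the only complementary pair `(x, y)` with `x + Q y = 0` is zero. -/
theorem Nondegenerate.eq_zero_of_add_mulVec_eq_zero {n : ℕ} {Q : Matrix (Fin n) (Fin n) ℝ}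
    (hQ : _root_.Nondegenerate Q) {x y : Fin n → ℝ} (hxy : ∀ i, x i * y i = 0)
    (h : x + Q *ᵥ y = 0) : x = 0 ∧ y = 0 := by
  have hy : y = 0 := by
    let Λ : Finset (Fin n) := Finset.univ.filter fun i => y i ≠ 0
    have hker : Q.submatrix (fun i : Λ => (i : Fin n)) (fun j : Λ => (j : Fin n)) *ᵥ
        (fun i : Λ => y i) = 0 := by
      ext ⟨i, hi⟩
      have hyi : y i ≠ 0 := by simpa [Λ] using hi
      have hx : x i = 0 := (mul_eq_zero.mp (hxy i)).resolve_right hyi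
      have hQi : ∑ j, Q i j * y j = 0 := by
        simpa [hx, mulVec, dotProduct] using congrFun h i
      have hsum : ∑ j ∈ Λ, Q i j * y j = ∑ j, Q i j * y j :=
        Finset.sum_subset (Finset.subset_univ _) fun j _ hj => by
          have : y j = 0 := by simpa [Λ] using hj
          simp [this]
      rw [← Finset.sum_coe_sort] at hsum
      exact hsum.trans hQi
    have hzero := eq_zero_of_mulVec_eq_zero (hQ Λ) hker
    ext i
    by_contra hi
    exact hi (congrFun hzero ⟨i, by simpa [Λ] using hi⟩)
  refine ⟨?_, hy⟩
  simpa [hy] using h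

open Matrix in
/-- Linear combinations of the columns of `[Iₙ Q]`. -/
theorem linearCombination_Dcol {n : ℕ} (Q : Matrix (Fin n) (Fin n) ℝ)
    (l : Fin n ⊕ Fin n →₀ ℝ) :
    Finsupp.linearCombination ℝ (Dcol Q) l =
      (fun i => l (Sum.inl i)) + Q *ᵥ (fun i => l (Sum.inr i)) := by
  ext k
  rw [Finsupp.linearCombination_apply, Finsupp.sum_fintype _ _ (by simp)]
  simp [Dcol, mulVec, dotProduct, Pi.single_apply, mul_comm]

theorem Nondegenerate.linearIndepOn_Dcol {n : ℕ} {Q : Matrix (Fin n) (Fin n) ℝ}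
    (hQ : Nondegenerate Q) {s : Set (Fin n ⊕ Fin n)}
    (hs : ∀ i, Sum.inl i ∉ s ∨ Sum.inr i ∉ s) : LinearIndepOn ℝ (Dcol Q) s := by
  rw [linearIndepOn_iff]
  intro l hl h
  rw [linearCombination_Dcol] at h
  rw [Finsupp.mem_supported'] at hl
  obtain ⟨hx, hy⟩ := hQ.eq_zero_of_add_mulVec_eq_zero
    (fun i => mul_eq_zero.mpr ((hs i).imp (hl _) (hl _))) h
  ext (i | i)
  · exact congrFun hx i
  · exact congrFun hy i

open Matrix in
/-- A vector orthogonal to the kernel of `T` lies in the kernel of `[Iₙ Q]`. -/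
theorem add_mulVec_eq_zero_of_orthogonal_ker {n : ℕ} {A B : Matrix (Fin n) (Fin n) ℝ}
    (hAB : IsUnit (A - B)) {w : EuclideanSpace ℝ (Fin n ⊕ Fin n)}
    (hw : ∀ z : EuclideanSpace ℝ (Fin n ⊕ Fin n), Tmap A B z = 0 → ⟪w, z⟫ = 0) :
    (fun i => w (Sum.inl i)) + ((Aᵀ + Bᵀ) * (Aᵀ - Bᵀ)⁻¹) *ᵥ (fun i => w (Sum.inr i)) = 0 := by
  set Q := (Aᵀ + Bᵀ) * (Aᵀ - Bᵀ)⁻¹ with hQ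
  have hQT : (A - B) * Qᵀ = A + B := by
    rw [hQ, transpose_mul, transpose_nonsing_inv, transpose_sub, transpose_add]
    simp only [transpose_transpose]
    exact mul_nonsing_inv_cancel_left _ _ ((isUnit_iff_isUnit_det _).mp hAB)
  set u : Fin n → ℝ := fun i => w (Sum.inl i) with hu
  set v : Fin n → ℝ := fun i => w (Sum.inr i) with hv
  set a := u + Q *ᵥ v with ha
  have hker : Tmap A B (WithLp.toLp 2 (Sum.elim a (Qᵀ *ᵥ a))) = 0 := by
    change (A + B) *ᵥ a + (-A + B) *ᵥ (Qᵀ *ᵥ a) = 0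
    rw [show -A + B = -(A - B) by abel, neg_mulVec, mulVec_mulVec,
      hQT, add_neg_cancel]
  have horth : u ⬝ᵥ a + v ⬝ᵥ Qᵀ *ᵥ a = 0 := by
    simpa [PiLp.inner_apply, dotProduct, mul_comm, hu, hv] using hw _ hker
  rw [mulVec_transpose, dotProduct_comm v, ← dotProduct_mulVec, dotProduct_comm u,
    ← dotProduct_add, ← ha] at horth
  exact dotProduct_self_eq_zero.mp horth

theorem nondegenerate_implies_linreg {n : ℕ} (A B : Matrix (Fin n) (Fin n) ℝ)
    (hAB : IsUnit (A - B))
    (hQnd : Nondegenerate ((A.transpose + B.transpose) * (A.transpose - B.transpose)⁻¹))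
    (Λ1 : Finset (Fin n)) :
    LinearIndependent ℝ
      (fun j : ↥((Sum.inl '' (Λ1 : Set (Fin n))) ∪
          (Sum.inr '' {i : Fin n | i ∉ Λ1})) =>
        Dcol ((A.transpose + B.transpose) * (A.transpose - B.transpose)⁻¹) (j : Fin n ⊕ Fin n)) ∧
    (∀ w : EuclideanSpace ℝ (Fin n ⊕ Fin n),
      (∀ z : EuclideanSpace ℝ (Fin n ⊕ Fin n), Tmap A B z = 0 → ⟪w, z⟫ = 0) →
      (∀ i, w (Sum.inl i) * w (Sum.inr i) = 0) → w = 0) := by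
  refine ⟨hQnd.linearIndepOn_Dcol fun i => ?_, fun w hw hcomp => ?_⟩
  · by_cases hi : i ∈ Λ1 <;> simp [hi]
  · obtain ⟨hu, hv⟩ := hQnd.eq_zero_of_add_mulVec_eq_zero hcomp
      (add_mulVec_eq_zero_of_orthogonal_ker hAB hw)
    ext (i | i)
    · exact congrFun hu i
    · exact congrFun hv i
end
end

section
/- Let A, B ∈ ℝ^{m×n} and c ∈ ℝ^m. Suppose that C1 ∩ R_τ ≠ ∅ for every function τ : {1,…,n} → {1,2}, where R_τ = {(u,v) ∈ ℝ^n × ℝ^n : for each i, (u_i,v_i) ∈ M_{τ(i)}}, with M1 = {(a,0) : a ≥ 0} and M2 = {(0,b) : b ≥ 0}. Then Fix(P_{C1} ∘ P_{C2}) = C1 ∩ C2. -/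
noncomputable section

/-- The set of fixed points of `P_{C1} ∘ P_{C2}`. -/
def FixSet {m n : ℕ} (A B : Matrix (Fin m) (Fin n) ℝ) (c : Fin m → ℝ) :
    Set (EuclideanSpace ℝ (Fin n ⊕ Fin n)) :=
  {w | ∃ w' ∈ projSet (C2set n) w, w ∈ projSet (C1set A B c) w'}

/-- `R_τ` for `τ : {1,…,n} → {1,2}`, encoded as `τ : Fin n → Fin 2`:
`τ i = 0` means `(u_i,v_i) ∈ M1 = {(a,0) : a ≥ 0}`, and
`τ i = 1` means `(u_i,v_i) ∈ M2 = {(0,b) : b ≥ 0}`. -/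
def Rtau {n : ℕ} (τ : Fin n → Fin 2) : Set (EuclideanSpace ℝ (Fin n ⊕ Fin n)) :=
  {w | ∀ i, (τ i = 0 → 0 ≤ w (Sum.inl i) ∧ w (Sum.inr i) = 0) ∧
            (τ i = 1 → w (Sum.inl i) = 0 ∧ 0 ≤ w (Sum.inr i))}

/-- The variational inequality for a nearest point of a convex set. -/
theorem inner_sub_nonpos_of_mem_projSet {E : Type*} [NormedAddCommGroup E] [InnerProductSpace ℝ E]
    {K : Set E} (hK : Convex ℝ K) {z s x : E} (hs : s ∈ projSet K z) (hx : x ∈ K) :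
    inner ℝ (z - s) (x - s) ≤ 0 := by
  refine (norm_eq_iInf_iff_real_inner_le_zero hK hs.1).1 ?_ x hx
  have : Nonempty K := ⟨⟨s, hs.1⟩⟩
  refine le_antisymm (le_ciInf fun t => ?_) ?_
  · rw [norm_sub_rev z s, norm_sub_rev z t]
    exact hs.2 t t.2
  · exact ciInf_le ⟨0, by rintro _ ⟨t, rfl⟩; exact norm_nonneg _⟩ (⟨s, hs.1⟩ : K)

/-- Mutually nearest points of two convex sets with a common point coincide. -/
theorem eq_of_mem_projSet_of_mem_projSet {E : Type*} [NormedAddCommGroup E]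
    [InnerProductSpace ℝ E] {K L : Set E} (hK : Convex ℝ K) (hL : Convex ℝ L)
    (hKL : (K ∩ L).Nonempty) {s z : E} (hs : s ∈ projSet K z) (hz : z ∈ projSet L s) :
    s = z := by
  obtain ⟨x, hxK, hxL⟩ := hKL
  have h₁ := inner_sub_nonpos_of_mem_projSet hK hs hxK
  have h₂ := inner_sub_nonpos_of_mem_projSet hL hz hxL
  have h : inner ℝ (z - s) (z - s) ≤ 0 := by
    have e : inner ℝ (z - s) (z - s) = inner ℝ (z - s) (x - s) + inner ℝ (s - z) (x - z) := by
      rw [← neg_sub z s, inner_neg_left, ← sub_eq_add_neg, ← inner_sub_right]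
      congr 1
      abel
    linarith
  exact (sub_eq_zero.1 (real_inner_self_nonpos.1 h)).symm

theorem self_mem_projSet {E : Type*} [NormedAddCommGroup E] {S : Set E} {z : E} (hz : z ∈ S) :
    z ∈ projSet S z :=
  ⟨hz, fun t _ => by simp⟩

theorem projSet_of_subset {E : Type*} [NormedAddCommGroup E] {S S' : Set E} (hS : S' ⊆ S)
    {z s : E} (hs : s ∈ projSet S z) (hs' : s ∈ S') : s ∈ projSet S' z :=
  ⟨hs', fun t ht => hs.2 t (hS ht)⟩

theorem convex_Rtau {n : ℕ} (τ : Fin n → Fin 2) : Convex ℝ (Rtau τ) := by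
  intro x hx y hy a b ha hb _ i
  simp only [PiLp.add_apply, PiLp.smul_apply, smul_eq_mul]
  constructor
  · intro hi
    obtain ⟨hx₁, hx₂⟩ := (hx i).1 hi
    obtain ⟨hy₁, hy₂⟩ := (hy i).1 hi
    exact ⟨by positivity, by simp [hx₂, hy₂]⟩
  · intro hi
    obtain ⟨hx₁, hx₂⟩ := (hx i).2 hi
    obtain ⟨hy₁, hy₂⟩ := (hy i).2 hi
    exact ⟨by simp [hx₁, hy₁], by positivity⟩

theorem Rtau_subset_C2set {n : ℕ} (τ : Fin n → Fin 2) : Rtau τ ⊆ C2set n := by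
  intro w hw
  have key (i : Fin n) :
      0 ≤ w (Sum.inl i) ∧ 0 ≤ w (Sum.inr i) ∧ w (Sum.inl i) * w (Sum.inr i) = 0 := by
    obtain hi | hi : τ i = 0 ∨ τ i = 1 := by lia
    · obtain ⟨h₁, h₂⟩ := (hw i).1 hi
      simp [h₁, h₂]
    · obtain ⟨h₁, h₂⟩ := (hw i).2 hi
      simp [h₁, h₂]
  exact ⟨fun i => (key i).1, fun i => (key i).2.1, Finset.sum_eq_zero fun i _ => (key i).2.2⟩

theorem exists_mem_Rtau {n : ℕ} {w : EuclideanSpace ℝ (Fin n ⊕ Fin n)} (hw : w ∈ C2set n) :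
    ∃ τ, w ∈ Rtau τ := by
  classical
  obtain ⟨hu, hv, huv⟩ := hw
  rw [Finset.sum_eq_zero_iff_of_nonneg fun i _ => mul_nonneg (hu i) (hv i)] at huv
  refine ⟨fun i => if w (Sum.inr i) = 0 then 0 else 1, fun i => ?_⟩
  by_cases hi : w (Sum.inr i) = 0
  · simp [hi, hu i]
  · simpa [hi, hv i] using huv i (Finset.mem_univ i)

theorem fixed_points_eq_of_C1_meets_every_Rtau {m n : ℕ}
    (A B : Matrix (Fin m) (Fin n) ℝ) (c : Fin m → ℝ)
    (h : ∀ τ : Fin n → Fin 2, (C1set A B c ∩ Rtau τ).Nonempty) :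
    FixSet A B c = C1set A B c ∩ C2set n := by
  ext w
  constructor
  · rintro ⟨w', hw', hw⟩
    obtain ⟨τ, hτ⟩ := exists_mem_Rtau hw'.1
    obtain rfl : w' = w :=
      eq_of_mem_projSet_of_mem_projSet (convex_Rtau τ) (convex_C1set A B c)
        (Set.inter_comm _ _ ▸ h τ) (projSet_of_subset (Rtau_subset_C2set τ) hw' hτ) hw
    exact ⟨hw.1, hw'.1⟩
  · rintro ⟨h₁, h₂⟩
    exact ⟨w, self_mem_projSet h₂, self_mem_projSet h₁⟩
end
end

section
/- Define ψ : ℝ² → ℝ by ψ(s,t) = min(s,t)²/2 + max(−max(s,t), 0)²/2, and for (a,b) ∈ ℝ² define the set G(a,b) ⊆ ℝ² by: G(a,b) = {(a, −max(−b,0))} if a < b or (a = b and a ≤ 0); G(a,b) = {(−max(−a,0), b)} if a > b; G(a,b) = {(a,0), (0,b)} if a = b > 0. Then for every (a,b) ∈ ℝ² and every g ∈ G(a,b), one has 2ψ(a,b) ≤ ⟨g, (a,b)⟩. -/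
noncomputable section

/-- `ψ(s,t) = min(s,t)²/2 + max(−max(s,t), 0)²/2`. -/
def psi (s t : ℝ) : ℝ := min s t ^ 2 / 2 + max (-(max s t)) 0 ^ 2 / 2

/-- The B-subdifferential `G(a,b)` of `ψ` at `(a,b)`, given by the explicit case formula. -/
def Gsub (a b : ℝ) : Set (ℝ × ℝ) :=
  {g | ((a < b ∨ (a = b ∧ a ≤ 0)) ∧ g = (a, -(max (-b) 0))) ∨
       (a > b ∧ g = (-(max (-a) 0), b)) ∨
       ((a = b ∧ 0 < a) ∧ (g = (a, 0) ∨ g = (0, b)))}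

theorem two_mul_psi_of_le {a b : ℝ} (h : a ≤ b) :
    2 * psi a b = a * a + -(max (-b) 0) * b := by
  rw [psi, min_eq_left h, max_eq_right h]
  rcases le_total (-b) 0 with hb | hb
  · rw [max_eq_right hb]; ring
  · rw [max_eq_left hb]; ring

theorem psi_comm (a b : ℝ) : psi a b = psi b a := by
  rw [psi, psi, min_comm, max_comm a b]

theorem two_psi_le_inner_subgradient (a b : ℝ) (g : ℝ × ℝ) (hg : g ∈ Gsub a b) :
    2 * psi a b ≤ g.1 * a + g.2 * b := by
  rcases hg with ⟨h, rfl⟩ | ⟨h, rfl⟩ | ⟨⟨rfl, ha⟩, rfl | rfl⟩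
  · have hab : a ≤ b := h.elim le_of_lt fun h => h.1.le
    exact (two_mul_psi_of_le hab).le
  · rw [psi_comm, two_mul_psi_of_le h.le, add_comm]
  all_goals
    rw [two_mul_psi_of_le le_rfl, max_eq_right (neg_nonpos.mpr ha.le)]
    simp
end
end

section
/- Let m = n, let A, B ∈ ℝ^{n×n} with A − B nonsingular, and suppose Q = (Aᵀ+Bᵀ)(Aᵀ−Bᵀ)⁻¹ is nondegenerate. Suppose w* = (u*, v*) ∈ C1 ∩ C2 satisfies (u*_i, v*_i) ≠ (0,0) for all i = 1,…,n. Then there exist δ > 0 and ρ ∈ [0,1) such that every sequence (w^k) with w^{k+1} ∈ P_{C1}(P_{C2}(w^k)) and ‖w^0 − w*‖ < δ satisfies ‖w^{k+1} − w*‖ ≤ ρ ‖w^k − w*‖ for all k ≥ 0; in particular (w^k) converges linearly to w*. -/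
noncomputable section

/-- The composition of the orthogonal projection onto `N` with the inclusion of a subspace `S`
meeting `N` trivially is a strict contraction. -/
theorem exists_norm_starProjection_le_of_disjoint {E : Type*} [NormedAddCommGroup E]
    [InnerProductSpace ℝ E] [FiniteDimensional ℝ E] (N S : Submodule ℝ E) (h : Disjoint N S) :
    ∃ ρ : ℝ, 0 ≤ ρ ∧ ρ < 1 ∧ ∀ x ∈ S, ‖N.starProjection x‖ ≤ ρ * ‖x‖ := by
  let f : S →ₗ[ℝ] E := Nᗮ.starProjection.toLinearMap ∘ₗ S.subtype
  have hf : LinearMap.ker f = ⊥ := by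
    rw [LinearMap.ker_eq_bot']
    intro x hx
    have hx' : Nᗮ.starProjection (x : E) = 0 := hx
    rw [Submodule.starProjection_apply_eq_zero_iff, Submodule.orthogonal_orthogonal] at hx'
    exact Subtype.ext (Submodule.disjoint_def.1 h _ hx' x.2)
  obtain ⟨K, hK, hfK⟩ := f.exists_antilipschitzWith hf
  have hK' : (0 : ℝ) < K := hK
  refine ⟨√(1 - 1 / (1 + K ^ 2)), Real.sqrt_nonneg _, ?_, fun x hx => ?_⟩
  · rw [Real.sqrt_lt' one_pos]
    have : (0 : ℝ) < 1 / (1 + K ^ 2) := by positivity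
    linarith
  · have h1 : ‖x‖ ≤ K * ‖Nᗮ.starProjection x‖ := by
      simpa [f] using hfK.le_mul_dist (⟨x, hx⟩ : S) 0
    have h2 := Submodule.norm_sq_eq_add_norm_sq_starProjection x N
    have h3 : 1 / (1 + (K : ℝ) ^ 2) ≤ 1 := by
      rw [div_le_one (by positivity)]; nlinarith
    refine le_of_sq_le_sq ?_ (by positivity)
    rw [mul_pow, Real.sq_sqrt (by linarith)]
    have h4 : ‖x‖ ^ 2 ≤ K ^ 2 * ‖Nᗮ.starProjection x‖ ^ 2 := by
      rw [← mul_pow]; gcongr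
    have h5 : 1 / (1 + (K : ℝ) ^ 2) * ‖x‖ ^ 2 ≤ ‖Nᗮ.starProjection x‖ ^ 2 := by
      rw [one_div, inv_mul_le_iff₀ (by positivity)]
      nlinarith [sq_nonneg ‖Nᗮ.starProjection x‖]
    linarith

/-- The metric projection onto a translate `a + N` of a subspace is given by the orthogonal
projection onto `N`. -/
theorem sub_eq_starProjection_of_mem_projSet {E : Type*} [NormedAddCommGroup E]
    [InnerProductSpace ℝ E] {N : Submodule ℝ E} [N.HasOrthogonalProjection] {S : Set E} {a : E}
    (hS : ∀ s, s ∈ S ↔ s - a ∈ N) {z s : E} (hs : s ∈ projSet S z) :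
    s - a = N.starProjection (z - a) := by
  set p := N.starProjection (z - a) with hp
  have hpN : p ∈ N := N.starProjection_apply_mem _
  have hsN := (hS s).1 hs.1
  have hle := hs.2 (a + p) ((hS _).2 (by simpa using hpN))
  have horth : inner ℝ (s - a - p) (p - (z - a)) = 0 := by
    rw [← neg_sub (z - a) p, inner_neg_right, real_inner_comm, neg_eq_zero]
    exact N.starProjection_inner_eq_zero _ _ (N.sub_mem hsN hpN)
  have hpyth := norm_add_sq_eq_norm_sq_add_norm_sq_of_inner_eq_zero _ _ horth
  rw [show s - a - p + (p - (z - a)) = s - z by abel,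
    show p - (z - a) = a + p - z by abel] at hpyth
  have h0 : ‖s - a - p‖ = 0 := by
    nlinarith [norm_nonneg (s - z), norm_nonneg (a + p - z), norm_nonneg (s - a - p)]
  exact sub_eq_zero.1 (norm_eq_zero.1 h0)

/-- The complementary coordinate subspace of pairs `(u, v)` with `u` supported on `Λ` and `v`
supported on the complement of `Λ`. -/
def complSubspace {n : ℕ} (Λ : Finset (Fin n)) :
    Submodule ℝ (EuclideanSpace ℝ (Fin n ⊕ Fin n)) where
  carrier := {w | (∀ i ∉ Λ, w (Sum.inl i) = 0) ∧ ∀ i ∈ Λ, w (Sum.inr i) = 0}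
  add_mem' := by
    rintro x y ⟨hx, hx'⟩ ⟨hy, hy'⟩
    exact ⟨fun i hi => by simp [hx i hi, hy i hi], fun i hi => by simp [hx' i hi, hy' i hi]⟩
  zero_mem' := by simp
  smul_mem' := by
    rintro r x ⟨hx, hx'⟩
    exact ⟨fun i hi => by simp [hx i hi], fun i hi => by simp [hx' i hi]⟩

/-- `Tmap` as a linear map. -/
def TmapLinear {m n : ℕ} (A B : Matrix (Fin m) (Fin n) ℝ) :
    EuclideanSpace ℝ (Fin n ⊕ Fin n) →ₗ[ℝ] (Fin m → ℝ) where
  toFun := Tmap A B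
  map_add' x y := by
    have h1 : (fun i => (x + y) (Sum.inl i)) = (fun i => x (Sum.inl i)) + fun i => y (Sum.inl i) :=
      rfl
    have h2 : (fun i => (x + y) (Sum.inr i)) = (fun i => x (Sum.inr i)) + fun i => y (Sum.inr i) :=
      rfl
    simp only [Tmap, h1, h2, Matrix.mulVec_add]
    abel
  map_smul' r x := by
    have h1 : (fun i => (r • x) (Sum.inl i)) = r • fun i => x (Sum.inl i) := rfl
    have h2 : (fun i => (r • x) (Sum.inr i)) = r • fun i => x (Sum.inr i) := rfl
    simp only [Tmap, h1, h2, Matrix.mulVec_smul, smul_add, RingHom.id_apply]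

theorem Nondegenerate.eq_zero_of_mulVec_eq_zero {n : ℕ} {M : Matrix (Fin n) (Fin n) ℝ}
    (hM : Nondegenerate M.transpose) (Λ : Finset (Fin n)) {u : Fin n → ℝ}
    (hu : ∀ i ∉ Λ, u i = 0) (hMu : ∀ i ∈ Λ, M.mulVec u i = 0) : u = 0 := by
  have hdet := hM Λ
  rw [← Matrix.transpose_submatrix, Matrix.det_transpose] at hdet
  have hΛ : (fun i : Λ => u i) = 0 := by
    refine Matrix.eq_zero_of_mulVec_eq_zero hdet ?_
    ext i
    rw [Pi.zero_apply, ← hMu i i.2]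
    simp only [Matrix.mulVec, dotProduct, Matrix.submatrix_apply]
    rw [Finset.sum_coe_sort Λ (fun j => M i j * u j)]
    exact Finset.sum_subset (Finset.subset_univ _) fun j _ hj => by simp [hu j hj]
  ext i
  by_cases hi : i ∈ Λ
  · exact congrFun hΛ ⟨i, hi⟩
  · exact hu i hi

theorem disjoint_ker_TmapLinear_complSubspace {n : ℕ} {A B : Matrix (Fin n) (Fin n) ℝ}
    (hAB : IsUnit (A - B))
    (hQnd : Nondegenerate ((A.transpose + B.transpose) * (A.transpose - B.transpose)⁻¹))
    (Λ : Finset (Fin n)) :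
    Disjoint (LinearMap.ker (TmapLinear A B)) (complSubspace Λ) := by
  rw [Submodule.disjoint_def]
  rintro w hw ⟨hu, hv⟩
  have hdet : IsUnit (A - B).det := (Matrix.isUnit_iff_isUnit_det _).1 hAB
  have hQ : (A.transpose + B.transpose) * (A.transpose - B.transpose)⁻¹ =
      ((A - B)⁻¹ * (A + B)).transpose := by
    rw [Matrix.transpose_mul, Matrix.transpose_nonsing_inv, Matrix.transpose_add,
      Matrix.transpose_sub]
  rw [hQ] at hQnd
  have hw' : (A + B).mulVec (fun i => w (Sum.inl i)) =
      (A - B).mulVec (fun i => w (Sum.inr i)) := by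
    have h : (A + B).mulVec (fun i => w (Sum.inl i)) +
      (-A + B).mulVec (fun i => w (Sum.inr i)) = 0 := hw
    rw [← neg_sub A B |>.trans (by abel : B - A = -A + B), Matrix.neg_mulVec] at h
    exact add_neg_eq_zero.1 h
  have hMu : ((A - B)⁻¹ * (A + B)).mulVec (fun i => w (Sum.inl i)) =
      fun i => w (Sum.inr i) := by
    rw [← Matrix.mulVec_mulVec, hw', Matrix.mulVec_mulVec, Matrix.nonsing_inv_mul _ hdet,
      Matrix.one_mulVec]
  have hu0 : (fun i => w (Sum.inl i)) = 0 :=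
    hQnd.eq_zero_of_mulVec_eq_zero Λ hu fun i hi => by rw [hMu]; exact hv i hi
  have hv0 : (fun i => w (Sum.inr i)) = 0 := by rw [← hMu, hu0, Matrix.mulVec_zero]
  ext i
  rcases i with i | i
  · exact congrFun hu0 i
  · exact congrFun hv0 i

theorem mem_C2set_iff {n : ℕ} {w : EuclideanSpace ℝ (Fin n ⊕ Fin n)} :
    w ∈ C2set n ↔ ∀ i, 0 ≤ w (Sum.inl i) ∧ 0 ≤ w (Sum.inr i) ∧
      w (Sum.inl i) * w (Sum.inr i) = 0 := by
  constructor
  · rintro ⟨hu, hv, h⟩ i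
    rw [Finset.sum_eq_zero_iff_of_nonneg fun i _ => mul_nonneg (hu i) (hv i)] at h
    exact ⟨hu i, hv i, h i (Finset.mem_univ i)⟩
  · exact fun h => ⟨fun i => (h i).1, fun i => (h i).2.1, Finset.sum_eq_zero fun i _ => (h i).2.2⟩

/-- If on each index the coordinate selected by `Λ` is positive and dominates the other one, the
projection onto `C2` keeps the selected coordinates and annihilates the others. -/
theorem projSet_C2set_apply {n : ℕ} {Λ : Finset (Fin n)}
    {w w' : EuclideanSpace ℝ (Fin n ⊕ Fin n)}
    (hΛ : ∀ i ∈ Λ, |w (Sum.inr i)| < w (Sum.inl i))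
    (hΛ' : ∀ i ∉ Λ, |w (Sum.inl i)| < w (Sum.inr i)) (hw' : w' ∈ projSet (C2set n) w) (i : Fin n) :
    (i ∈ Λ → w' (Sum.inl i) = w (Sum.inl i) ∧ w' (Sum.inr i) = 0) ∧
      (i ∉ Λ → w' (Sum.inl i) = 0 ∧ w' (Sum.inr i) = w (Sum.inr i)) := by
  let t : EuclideanSpace ℝ (Fin n ⊕ Fin n) := WithLp.toLp 2
    (Sum.elim (fun i => if i ∈ Λ then w (Sum.inl i) else 0)
      (fun i => if i ∈ Λ then 0 else w (Sum.inr i)))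
  have htl : ∀ i, t (Sum.inl i) = if i ∈ Λ then w (Sum.inl i) else 0 := fun _ => rfl
  have htr : ∀ i, t (Sum.inr i) = if i ∈ Λ then 0 else w (Sum.inr i) := fun _ => rfl
  have ht : t ∈ C2set n := by
    refine mem_C2set_iff.2 fun i => ?_
    rw [htl, htr]
    by_cases hi : i ∈ Λ
    · simpa [hi] using (abs_nonneg _).trans (hΛ i hi).le
    · simpa [hi] using (abs_nonneg _).trans (hΛ' i hi).le
  have hC := mem_C2set_iff.1 hw'.1
  let gap : Fin n → ℝ := fun i =>
    (w' (Sum.inl i) - w (Sum.inl i)) ^ 2 + (w' (Sum.inr i) - w (Sum.inr i)) ^ 2 -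
      ((t (Sum.inl i) - w (Sum.inl i)) ^ 2 + (t (Sum.inr i) - w (Sum.inr i)) ^ 2)
  have hsum : ∑ i, gap i ≤ 0 := by
    have h := pow_le_pow_left₀ (norm_nonneg _) (hw'.2 t ht) 2
    simp only [EuclideanSpace.real_norm_sq_eq, Fintype.sum_sum_type, PiLp.sub_apply] at h
    simp only [gap, Finset.sum_sub_distrib, Finset.sum_add_distrib]
    linarith
  have hcase : ∀ i, 0 ≤ gap i ∧ (gap i = 0 →
      (i ∈ Λ → w' (Sum.inl i) = w (Sum.inl i) ∧ w' (Sum.inr i) = 0) ∧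
      (i ∉ Λ → w' (Sum.inl i) = 0 ∧ w' (Sum.inr i) = w (Sum.inr i))) := by
    intro i
    simp only [gap, htl, htr]
    by_cases hi : i ∈ Λ
    · have hlt := sq_lt_sq' (neg_lt_of_abs_lt (hΛ i hi)) (lt_of_abs_lt (hΛ i hi))
      rcases mul_eq_zero.1 (hC i).2.2 with h0 | h0
      · simp only [hi, h0, if_true, not_true, false_imp_iff, true_imp_iff, and_true]
        have := sq_nonneg (w' (Sum.inr i) - w (Sum.inr i))
        exact ⟨by nlinarith, fun h => by nlinarith⟩
      · simp only [hi, h0, if_true, not_true, false_imp_iff, true_imp_iff, and_true]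
        exact ⟨by nlinarith [sq_nonneg (w' (Sum.inl i) - w (Sum.inl i))], fun h =>
          sub_eq_zero.1 (pow_eq_zero_iff two_ne_zero |>.1 (by linarith))⟩
    · have hlt := sq_lt_sq' (neg_lt_of_abs_lt (hΛ' i hi)) (lt_of_abs_lt (hΛ' i hi))
      rcases mul_eq_zero.1 (hC i).2.2 with h0 | h0
      · simp only [hi, h0, if_false, not_false_iff, false_imp_iff, true_imp_iff, true_and]
        exact ⟨by nlinarith [sq_nonneg (w' (Sum.inr i) - w (Sum.inr i))], fun h =>
          sub_eq_zero.1 (pow_eq_zero_iff two_ne_zero |>.1 (by linarith))⟩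
      · simp only [hi, h0, if_false, not_false_iff, false_imp_iff, true_imp_iff, true_and]
        have := sq_nonneg (w' (Sum.inl i) - w (Sum.inl i))
        exact ⟨by nlinarith, fun h => by nlinarith⟩
  have hzero : gap i = 0 :=
    (Finset.sum_eq_zero_iff_of_nonneg fun i _ => (hcase i).1).1
      (hsum.antisymm (Finset.sum_nonneg fun i _ => (hcase i).1)) i (Finset.mem_univ i)
  exact (hcase i).2 hzero

/-- Near a strictly complementary point `a`, the projection onto `C2` takes values in a translate
by `a` of a coordinate subspace, and does not increase the distance to `a`. -/
theorem exists_projSet_C2set_near {n : ℕ} {a : EuclideanSpace ℝ (Fin n ⊕ Fin n)}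
    (ha : a ∈ C2set n) (hnz : ∀ i, ¬(a (Sum.inl i) = 0 ∧ a (Sum.inr i) = 0)) :
    ∃ Λ : Finset (Fin n), ∃ δ > 0, ∀ w w', ‖w - a‖ < δ → w' ∈ projSet (C2set n) w →
      w' - a ∈ complSubspace Λ ∧ ‖w' - a‖ ≤ ‖w - a‖ := by
  have hC := mem_C2set_iff.1 ha
  obtain ⟨δ, hδ, hδa⟩ : ∃ δ > (0 : ℝ), ∀ i, 2 * δ < a (Sum.inl i) + a (Sum.inr i) := by
    have h : ∀ᶠ δ : ℝ in nhdsWithin 0 (Set.Ioi 0),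
        ∀ i, 2 * δ < a (Sum.inl i) + a (Sum.inr i) := by
      rw [Filter.eventually_all]
      intro i
      have hpos : 0 < a (Sum.inl i) + a (Sum.inr i) :=
        lt_of_le_of_ne (add_nonneg (hC i).1 (hC i).2.1) fun h =>
          hnz i ((add_eq_zero_iff_of_nonneg (hC i).1 (hC i).2.1).1 h.symm)
      have hcont : Continuous fun δ : ℝ => 2 * δ := by fun_prop
      exact (hcont.tendsto' 0 0 (by simp)).eventually_lt_const hpos |>.filter_mono
        nhdsWithin_le_nhds
    obtain ⟨δ, h, hδ⟩ := (h.and self_mem_nhdsWithin).exists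
    exact ⟨δ, hδ, h⟩
  refine ⟨Finset.univ.filter fun i => 0 < a (Sum.inl i), δ, hδ, fun w w' hw hw' => ?_⟩
  have hcoord : ∀ j, |w j - a j| < δ := fun j => (PiLp.norm_apply_le (w - a) j).trans_lt hw
  have hin : ∀ i, 0 < a (Sum.inl i) → a (Sum.inr i) = 0 := fun i hi =>
    (mul_eq_zero.1 (hC i).2.2).resolve_left hi.ne'
  have hout : ∀ i, ¬0 < a (Sum.inl i) → a (Sum.inl i) = 0 := fun i hi =>
    le_antisymm (not_lt.1 hi) (hC i).1
  have hproj := projSet_C2set_apply (Λ := Finset.univ.filter fun i => 0 < a (Sum.inl i))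
    (fun i hi => by
      have h0 := hin i (Finset.mem_filter.1 hi).2
      have h1 := abs_lt.1 (hcoord (Sum.inl i))
      have h2 := abs_lt.1 (hcoord (Sum.inr i))
      have h3 := hδa i
      rw [abs_lt]
      constructor <;> linarith)
    (fun i hi => by
      have h0 := hout i fun h => hi (Finset.mem_filter.2 ⟨Finset.mem_univ i, h⟩)
      have h1 := abs_lt.1 (hcoord (Sum.inl i))
      have h2 := abs_lt.1 (hcoord (Sum.inr i))
      have h3 := hδa i
      rw [abs_lt]
      constructor <;> linarith) hw'
  simp only [Finset.mem_filter, Finset.mem_univ, true_and] at hproj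
  refine ⟨⟨fun i hi => ?_, fun i hi => ?_⟩, ?_⟩
  · simp only [Finset.mem_filter, Finset.mem_univ, true_and] at hi
    simp [((hproj i).2 hi).1, hout i hi]
  · simp only [Finset.mem_filter, Finset.mem_univ, true_and] at hi
    simp [((hproj i).1 hi).2, hin i hi]
  · refine le_of_sq_le_sq ?_ (norm_nonneg _)
    simp only [EuclideanSpace.real_norm_sq_eq, PiLp.sub_apply]
    refine Finset.sum_le_sum fun j _ => ?_
    rcases j with i | i <;> by_cases hi : 0 < a (Sum.inl i)
    · rw [((hproj i).1 hi).1]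
    · rw [((hproj i).2 hi).1, hout i hi]
      simpa using sq_nonneg _
    · rw [((hproj i).1 hi).2, hin i hi]
      simpa using sq_nonneg _
    · rw [((hproj i).2 hi).2]

theorem MAP_local_linear_convergence {n : ℕ}
    (A B : Matrix (Fin n) (Fin n) ℝ) (c : Fin n → ℝ) (hAB : IsUnit (A - B))
    (hQnd : Nondegenerate ((A.transpose + B.transpose) * (A.transpose - B.transpose)⁻¹))
    (wstar : EuclideanSpace ℝ (Fin n ⊕ Fin n))
    (hstar : wstar ∈ C1set A B c ∩ C2set n)
    (hnz : ∀ i, ¬(wstar (Sum.inl i) = 0 ∧ wstar (Sum.inr i) = 0)) :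
    ∃ δ > 0, ∃ ρ : ℝ, 0 ≤ ρ ∧ ρ < 1 ∧
      ∀ w : ℕ → EuclideanSpace ℝ (Fin n ⊕ Fin n),
        (∀ k, ∃ w' ∈ projSet (C2set n) (w k), w (k + 1) ∈ projSet (C1set A B c) w') →
        ‖w 0 - wstar‖ < δ →
        ∀ k, ‖w (k + 1) - wstar‖ ≤ ρ * ‖w k - wstar‖ := by
  obtain ⟨Λ, δ, hδ, hnear⟩ := exists_projSet_C2set_near hstar.2 hnz
  obtain ⟨ρ, hρ0, hρ1, hρ⟩ := exists_norm_starProjection_le_of_disjoint _ _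
    (disjoint_ker_TmapLinear_complSubspace hAB hQnd Λ)
  refine ⟨δ, hδ, ρ, hρ0, hρ1, fun w hw h0 => ?_⟩
  have hC1 : ∀ s, s ∈ C1set A B c ↔ s - wstar ∈ LinearMap.ker (TmapLinear A B) := fun s => by
    have hT : TmapLinear A B wstar = Real.sqrt 2 • c := hstar.1
    rw [LinearMap.mem_ker, map_sub, hT, sub_eq_zero]
    rfl
  have hstep : ∀ k, ‖w k - wstar‖ < δ → ‖w (k + 1) - wstar‖ ≤ ρ * ‖w k - wstar‖ := by
    intro k hk
    obtain ⟨w', hw', hnext⟩ := hw k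
    obtain ⟨hmem, hle⟩ := hnear _ _ hk hw'
    rw [sub_eq_starProjection_of_mem_projSet hC1 hnext]
    exact (hρ _ hmem).trans (by gcongr)
  have hball : ∀ k, ‖w k - wstar‖ < δ := by
    intro k
    induction k with
    | zero => exact h0
    | succ k ih =>
      exact ((hstep k ih).trans (mul_le_of_le_one_left (norm_nonneg _) hρ1.le)).trans_lt ih
  exact fun k => hstep k (hball k)
end
end
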